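/- Let (X,d) be a nonempty compact metric space, f : X → X a continuous, open, distance expanding, topologically transitive map, and φ : X → ℝ Hölder continuous. Then there exist P ∈ ℝ, r₀ > 0, C ∈ (0,1], and an f-invariant Borel probability measure μ on X such that for every x ∈ X and every n ≥ 0, C ≤ μ(B_n(x,r₀))·exp(nP − S_nφ(x)) ≤ C^{−1}; moreover P can be taken equal to lim_{n→∞} (1/n)·log Σ_{x ∈ f^{−n}(x₀)} exp(S_nφ(x)) for any x₀ ∈ X. -/

import Mathlib

open MeasureTheory Filter Metric Set

/-- `f` is distance expanding: there are `lam > 1` and `η > 0` with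
`dist (f x) (f y) ≥ lam * dist x y` whenever `dist x y ≤ η`. -/
def DistanceExpanding {X : Type*} [MetricSpace X] (f : X → X) : Prop :=
  ∃ lam > (1 : ℝ), ∃ η > (0 : ℝ), ∀ x y : X, dist x y ≤ η →
    lam * dist x y ≤ dist (f x) (f y)

/-- `f` is topologically transitive: for all nonempty open `U, V` there is
`n ≥ 0` with `f^[n] '' U ∩ V ≠ ∅`. -/
def TopologicallyTransitive {X : Type*} [TopologicalSpace X] (f : X → X) : Prop :=
  ∀ U V : Set X, IsOpen U → IsOpen V → U.Nonempty → V.Nonempty →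
    ∃ n : ℕ, (f^[n] '' U ∩ V).Nonempty

/-- `φ` is Hölder continuous: `|φ x - φ y| ≤ C * dist x y ^ b` for some
`C > 0` and `b ∈ (0, 1]`. -/
def HolderPotential {X : Type*} [MetricSpace X] (φ : X → ℝ) : Prop :=
  ∃ C > (0 : ℝ), ∃ b ∈ Set.Ioc (0 : ℝ) 1, ∀ x y : X, |φ x - φ y| ≤ C * dist x y ^ b

/-- Birkhoff sum `S_n φ (x) = ∑_{j<n} φ (f^j x)`. -/
def birkhoffSum' {X : Type*} (f : X → X) (φ : X → ℝ) (n : ℕ) (x : X) : ℝ :=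
  ∑ j ∈ Finset.range n, φ (f^[j] x)

/-- The Bowen ball `B_n(x, r) = {y : dist (f^j x) (f^j y) < r for all 0 ≤ j ≤ n}`. -/
def bowenBall {X : Type*} [MetricSpace X] (f : X → X) (n : ℕ) (x : X) (r : ℝ) : Set X :=
  {y | ∀ j ≤ n, dist (f^[j] x) (f^[j] y) < r}

/-- The `n`-th level tree sum `∑_{x ∈ f^{-n}(x₀)} exp (S_n φ (x))`
(a `tsum` over the fiber, which is finite in the situations considered). -/
noncomputable def treeSum {X : Type*} (f : X → X) (φ : X → ℝ) (n : ℕ) (x₀ : X) : ℝ :=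
  ∑' x : (f^[n] ⁻¹' {x₀} : Set X), Real.exp (birkhoffSum' f φ n x)


/-- Working package of dynamical facts used throughout the proof. -/
structure GSys {X : Type*} [MetricSpace X] (f : X → X) (lam ρ : ℝ) : Prop where
  lam_gt : 1 < lam
  pos : 0 < ρ
  expand : ∀ x y : X, dist x y ≤ 2 * ρ → lam * dist x y ≤ dist (f x) (f y)
  branch : ∀ x z : X, dist (f x) z < ρ → ∃ w, dist x w ≤ dist (f x) z ∧ f w = z
  surj : Function.Surjective f
  fin : ∀ (n : ℕ) (x : X), (f^[n] ⁻¹' {x}).Finite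

lemma surj_of_trans {X : Type*} [MetricSpace X] [CompactSpace X] [Nonempty X]
    (f : X → X) (hf : Continuous f) (hopen : IsOpenMap f)
    (htrans : TopologicallyTransitive f) : Function.Surjective f := by
  by_contra hns
  have hne : ((range f)ᶜ).Nonempty := by
    rw [Set.nonempty_compl]
    intro h
    exact hns (Set.range_eq_univ.1 h)
  obtain ⟨n, y, ⟨x, ⟨u, hu⟩, hxy⟩, hy⟩ := htrans (range f) (range f)ᶜ hopen.isOpen_range
    (isCompact_range hf).isClosed.isOpen_compl (range_nonempty f) hne
  apply hy
  rw [← hxy, ← hu, ← Function.iterate_succ_apply, Function.iterate_succ_apply']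
  exact mem_range_self _

lemma unif_open {X : Type*} [MetricSpace X] [CompactSpace X]
    (f : X → X) (hf : Continuous f) (hopen : IsOpenMap f) (η : ℝ) (hη : 0 < η) :
    ∃ ξ > (0 : ℝ), ∀ x z : X, dist (f x) z < ξ → ∃ w, dist x w ≤ η ∧ f w = z := by
  have := isCompact_univ.induction_on (X := X)
    (p := fun s => ∃ ξ > (0 : ℝ), ∀ x ∈ s, ∀ z : X, dist (f x) z < ξ →
      ∃ w, dist x w ≤ η ∧ f w = z) ⟨1, one_pos, by simp⟩
    (by
      rintro s t hst ⟨ξ, h0, h⟩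
      exact ⟨ξ, h0, fun x hx => h x (hst hx)⟩)
    (by
      rintro s t ⟨ξ, h0, h⟩ ⟨ξ', h0', h'⟩
      refine ⟨min ξ ξ', lt_min h0 h0', ?_⟩
      rintro x (hx | hx) z hz
      · exact h x hx z (hz.trans_le (min_le_left _ _))
      · exact h' x hx z (hz.trans_le (min_le_right _ _)))
    (by
      intro x _
      have ho : IsOpen (f '' ball x (η / 2)) := hopen _ isOpen_ball
      obtain ⟨ε, hε, hb⟩ := Metric.isOpen_iff.1 ho (f x)
        ⟨x, mem_ball_self (half_pos hη), rfl⟩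
      refine ⟨ball x (η / 2) ∩ f ⁻¹' ball (f x) (ε / 2), ?_, ε / 2, half_pos hε, ?_⟩
      · rw [nhdsWithin_univ]
        exact Filter.inter_mem (ball_mem_nhds _ (half_pos hη))
          (hf.continuousAt.preimage_mem_nhds (ball_mem_nhds _ (half_pos hε)))
      · rintro x' ⟨hx', hfx'⟩ z hz
        have hz' : z ∈ ball (f x) ε := by
          rw [mem_ball]
          have h1 : dist (f x') (f x) < ε / 2 := hfx'
          have := dist_triangle z (f x') (f x)
          rw [dist_comm z (f x')] at this
          linarith
        obtain ⟨w, hw, hwz⟩ := hb hz'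
        refine ⟨w, ?_, hwz⟩
        have h1 : dist x' x < η / 2 := hx'
        have h2 : dist w x < η / 2 := hw
        have := dist_triangle_right x' w x
        linarith)
  obtain ⟨ξ, h0, h⟩ := this
  exact ⟨ξ, h0, fun x => h x (mem_univ x)⟩

lemma fiber_finite {X : Type*} [MetricSpace X] [CompactSpace X]
    (f : X → X) (hf : Continuous f) (η : ℝ) (hη : 0 < η)
    (hinj : ∀ x y : X, dist x y ≤ η → f x = f y → x = y) (n : ℕ) (x : X) :
    (f^[n] ⁻¹' {x}).Finite := by
  have h1 : ∀ x, (f ⁻¹' {x}).Finite := by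
    intro x
    have hc : IsCompact (f ⁻¹' {x}) := (isClosed_singleton.preimage hf).isCompact
    refine hc.finite ?_
    rw [isDiscrete_iff_discreteTopology]
    refine DiscreteTopology.of_forall_le_dist hη ?_
    rintro ⟨y, hy⟩ ⟨z, hz⟩ hne
    by_contra hlt
    apply hne
    simp only [Subtype.dist_eq, not_le] at hlt
    exact Subtype.ext (hinj y z hlt.le ((show f y = x from hy).trans (show f z = x from hz).symm))
  induction n generalizing x with
  | zero => simp
  | succ n ih =>
    rw [Function.iterate_succ, Set.preimage_comp]
    exact (ih x).preimage' (fun b _ => h1 b)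

lemma exists_gsys {X : Type*} [MetricSpace X] [CompactSpace X] [Nonempty X]
    (f : X → X) (hf : Continuous f) (hopen : IsOpenMap f)
    (hexp : DistanceExpanding f) (htrans : TopologicallyTransitive f) :
    ∃ lam ρ, GSys f lam ρ := by
  obtain ⟨lam, hl, η, hη, he⟩ := hexp
  obtain ⟨ξ, hξ, hb⟩ := unif_open f hf hopen η hη
  refine ⟨lam, min (η / 2) ξ, hl, lt_min (half_pos hη) hξ, ?_, ?_,
    surj_of_trans f hf hopen htrans, ?_⟩
  · intro x y h
    refine he x y ?_
    have := min_le_left (η / 2) ξ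
    linarith
  · intro x z h
    obtain ⟨w, hw, rfl⟩ := hb x z (h.trans_le (min_le_right _ _))
    refine ⟨w, ?_, rfl⟩
    have := he x w hw
    nlinarith [dist_nonneg (x := x) (y := w)]
  · refine fiber_finite f hf η hη ?_
    intro x y h hxy
    have := he x y h
    rw [hxy, dist_self] at this
    have h0 := dist_nonneg (x := x) (y := y)
    exact dist_le_zero.1 (by nlinarith)

section
variable {X : Type*} [MetricSpace X] {f : X → X} {lam ρ : ℝ}

lemma GSys.bowen_branch (S : GSys f lam ρ) (n : ℕ) : ∀ (x z : X),
    dist (f^[n] x) z < ρ → ∃ w, (∀ j ≤ n, dist (f^[j] x) (f^[j] w) ≤ dist (f^[n] x) z) ∧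
      f^[n] w = z := by
  induction n with
  | zero =>
    intro x z _
    refine ⟨z, ?_, rfl⟩
    intro j hj
    obtain rfl : j = 0 := by omega
    simp
  | succ n ih =>
    intro x z h
    rw [Function.iterate_succ_apply'] at h
    obtain ⟨v, hv, hvz⟩ := S.branch _ _ h
    obtain ⟨w, hw, hwv⟩ := ih x v (hv.trans_lt h)
    refine ⟨w, ?_, ?_⟩
    · intro j hj
      rcases Nat.lt_or_ge j (n + 1) with h1 | h1
      · rw [Function.iterate_succ_apply']
        exact (hw j (by omega)).trans hv
      · obtain rfl : j = n + 1 := by omega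
        rw [Function.iterate_succ_apply' f n w, hwv, hvz]
    · rw [Function.iterate_succ_apply', hwv, hvz]

lemma GSys.bowen_inj (S : GSys f lam ρ) (n : ℕ) (x y : X)
    (h : ∀ j ≤ n, dist (f^[j] x) (f^[j] y) ≤ 2 * ρ) (hxy : f^[n] x = f^[n] y) : x = y := by
  induction n with
  | zero => simpa using hxy
  | succ n ih =>
    refine ih (fun j hj => h j (by omega)) ?_
    have := S.expand _ _ (h n (by omega))
    rw [← Function.iterate_succ_apply' f, ← Function.iterate_succ_apply' f, hxy, dist_self] at this
    have h0 := dist_nonneg (x := f^[n] x) (y := f^[n] y)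
    exact dist_le_zero.1 (by nlinarith [S.lam_gt])

lemma birkhoff_succ {X : Type*} (f : X → X) (φ : X → ℝ) (n : ℕ) (x : X) :
    birkhoffSum' f φ (n + 1) x = birkhoffSum' f φ n x + φ (f^[n] x) := by
  simp [birkhoffSum', Finset.sum_range_succ]

lemma birkhoff_add {X : Type*} (f : X → X) (φ : X → ℝ) (n m : ℕ) (x : X) :
    birkhoffSum' f φ (n + m) x = birkhoffSum' f φ m x + birkhoffSum' f φ n (f^[m] x) := by
  rw [Nat.add_comm n m]
  simp only [birkhoffSum', Finset.sum_range_add]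
  congr 1
  refine Finset.sum_congr rfl fun j _ => ?_
  rw [← Function.iterate_add_apply, Nat.add_comm]

lemma GSys.distortion (S : GSys f lam ρ) {φ : X → ℝ} (hφ : HolderPotential φ) :
    ∃ K : ℝ, 0 ≤ K ∧ ∀ (n : ℕ) (x y : X), (∀ j ≤ n, dist (f^[j] x) (f^[j] y) ≤ ρ) →
      |birkhoffSum' f φ n x - birkhoffSum' f φ n y| ≤ K := by
  obtain ⟨C, hC, b, ⟨hb, hb1⟩, h⟩ := hφ
  have hl : 1 < lam ^ b := Real.one_lt_rpow S.lam_gt hb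
  have hlp : 0 < lam := by linarith [S.lam_gt]
  have hp := S.pos
  set K := C / (lam ^ b - 1) with hK
  have hK0 : 0 < K := div_pos hC (by linarith)
  have hKe : K + C = K * lam ^ b := by
    have : K * (lam ^ b - 1) = C := by
      rw [hK]; exact div_mul_cancel₀ _ (by linarith)
    linarith
  have key : ∀ (n : ℕ) (x y : X), (∀ j ≤ n, dist (f^[j] x) (f^[j] y) ≤ ρ) →
      |birkhoffSum' f φ n x - birkhoffSum' f φ n y| ≤ K * dist (f^[n] x) (f^[n] y) ^ b := by
    intro n x y hd
    induction n with
    | zero => simp [birkhoffSum']; positivity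
    | succ n ih =>
      have h1 := ih (fun j hj => hd j (by omega))
      have h2 := h (f^[n] x) (f^[n] y)
      have h3 := S.expand (f^[n] x) (f^[n] y) (by linarith [hd n (by omega)])
      rw [← Function.iterate_succ_apply' f, ← Function.iterate_succ_apply' f] at h3
      have h4 := Real.rpow_le_rpow (by positivity) h3 hb.le
      rw [Real.mul_rpow hlp.le dist_nonneg] at h4
      rw [birkhoff_succ, birkhoff_succ]
      calc _ = |(birkhoffSum' f φ n x - birkhoffSum' f φ n y) + (φ (f^[n] x) - φ (f^[n] y))| := by
            congr 1; ring
        _ ≤ _ := abs_add_le _ _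
        _ ≤ (K + C) * dist (f^[n] x) (f^[n] y) ^ b := by linarith
        _ = K * (lam ^ b * dist (f^[n] x) (f^[n] y) ^ b) := by rw [hKe]; ring
        _ ≤ _ := by gcongr
  refine ⟨K * ρ ^ b, by positivity, fun n x y hd => (key n x y hd).trans ?_⟩
  have := hd n le_rfl
  gcongr

lemma GSys.reach [CompactSpace X] (S : GSys f lam ρ) (htrans : TopologicallyTransitive f)
    (s : ℝ) (hs : 0 < s) (hsρ : s ≤ ρ) :
    ∃ M : ℕ, ∀ u z : X, ∃ k ≤ M, ∃ w, dist u w < s ∧ f^[k] w = z := by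
  have := (isCompact_univ (X := X × X)).induction_on
    (p := fun A => ∃ M : ℕ, ∀ q ∈ A, ∃ k ≤ M, ∃ w, dist q.1 w < s ∧ f^[k] w = q.2) ⟨0, by simp⟩
    (by
      rintro A B hst ⟨ξ, h⟩
      exact ⟨ξ, fun x hx => h x (hst hx)⟩)
    (by
      rintro A B ⟨ξ, h⟩ ⟨ξ', h'⟩
      refine ⟨max ξ ξ', ?_⟩
      rintro q (hq | hq)
      · obtain ⟨k, hk, h⟩ := h q hq
        exact ⟨k, hk.trans (le_max_left _ _), h⟩
      · obtain ⟨k, hk, h⟩ := h' q hq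
        exact ⟨k, hk.trans (le_max_right _ _), h⟩)
    (by
      rintro ⟨u, z⟩ _
      obtain ⟨k, _, ⟨w, hw, rfl⟩, hz⟩ := htrans (ball u (s / 4)) (ball z (s / 4)) isOpen_ball
        isOpen_ball ⟨u, mem_ball_self (by linarith)⟩ ⟨z, mem_ball_self (by linarith)⟩
      refine ⟨ball u (s / 4) ×ˢ ball z (s / 4), ?_, k, ?_⟩
      · rw [nhdsWithin_univ]
        exact prod_mem_nhds (ball_mem_nhds _ (by linarith)) (ball_mem_nhds _ (by linarith))
      · rintro ⟨u', z'⟩ ⟨hu', hz'⟩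
        simp only [mem_ball] at hu' hz' hw hz
        have hd : dist (f^[k] w) z' < s / 2 := by
          have := dist_triangle_right (f^[k] w) z' z
          linarith
        obtain ⟨v, hv, hvz⟩ := S.bowen_branch k w z' (by linarith)
        refine ⟨k, le_rfl, v, ?_, hvz⟩
        have h0 : dist w v ≤ _ := hv 0 (Nat.zero_le _)
        have h1 := dist_triangle_right u' w u
        have h2 := dist_triangle u' w v
        show dist u' v < s
        linarith)
  obtain ⟨M, h⟩ := this
  exact ⟨M, fun u z => h (u, z) (mem_univ _)⟩
end

/-- Transfer operator iterates. -/
noncomputable def TT {X : Type*} (f : X → X) (hfin : ∀ (n : ℕ) (x : X), (f^[n] ⁻¹' {x}).Finite)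
    (φ : X → ℝ) (n : ℕ) (g : X → ℝ) (x : X) : ℝ :=
  ∑ y ∈ (hfin n x).toFinset, Real.exp (birkhoffSum' f φ n y) * g y

section
variable {X : Type*} {f : X → X} {hfin : ∀ (n : ℕ) (x : X), (f^[n] ⁻¹' {x}).Finite} {φ : X → ℝ}

lemma TT_mono (n : ℕ) {g h : X → ℝ} (hgh : ∀ y, g y ≤ h y) (x : X) :
    TT f hfin φ n g x ≤ TT f hfin φ n h x :=
  Finset.sum_le_sum fun y _ => mul_le_mul_of_nonneg_left (hgh y) (Real.exp_pos _).le

lemma TT_mul (n : ℕ) (c : ℝ) (g : X → ℝ) (x : X) :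
    TT f hfin φ n (fun y => c * g y) x = c * TT f hfin φ n g x := by
  simp only [TT, Finset.mul_sum]
  exact Finset.sum_congr rfl fun y _ => by ring

lemma TT_const (n : ℕ) (c : ℝ) (x : X) :
    TT f hfin φ n (fun _ => c) x = c * TT f hfin φ n (fun _ => 1) x := by
  rw [← TT_mul]; simp

lemma TT_nonneg (n : ℕ) {g : X → ℝ} (hg : ∀ y, 0 ≤ g y) (x : X) : 0 ≤ TT f hfin φ n g x :=
  Finset.sum_nonneg fun y _ => mul_nonneg (Real.exp_pos _).le (hg y)

lemma TT_single_le (n : ℕ) {g : X → ℝ} (hg : ∀ y, 0 ≤ g y) (x y : X) (hy : f^[n] y = x) :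
    Real.exp (birkhoffSum' f φ n y) * g y ≤ TT f hfin φ n g x :=
  Finset.single_le_sum (f := fun y => Real.exp (birkhoffSum' f φ n y) * g y)
    (fun y _ => mul_nonneg (Real.exp_pos _).le (hg y)) (by simpa using hy)

lemma TT_sum {ι : Type*} (s : Finset ι) (n : ℕ) (g : ι → X → ℝ) (x : X) :
    TT f hfin φ n (fun y => ∑ i ∈ s, g i y) x = ∑ i ∈ s, TT f hfin φ n (g i) x := by
  simp only [TT, Finset.mul_sum]
  exact Finset.sum_comm

lemma TT_comp (n : ℕ) (g : X → ℝ) (x : X) :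
    TT f hfin φ n (fun y => g (f^[n] y)) x = g x * TT f hfin φ n (fun _ => 1) x := by
  rw [← TT_mul]
  refine Finset.sum_congr rfl fun y hy => ?_
  have : f^[n] y = x := by simpa using hy
  simp only [this]; ring

lemma TT_add (n m : ℕ) (g : X → ℝ) (x : X) :
    TT f hfin φ (n + m) g x = TT f hfin φ n (TT f hfin φ m g) x := by
  classical
  have h := Finset.sum_fiberwise_of_maps_to (s := (hfin (n + m) x).toFinset)
    (t := (hfin n x).toFinset) (g := f^[m])
    (fun y hy => by
      have h1 : f^[n + m] y = x := by simpa using hy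
      rw [Function.iterate_add_apply] at h1
      simpa using h1)
    (fun y => Real.exp (birkhoffSum' f φ (n + m) y) * g y)
  unfold TT
  rw [← h]
  refine Finset.sum_congr rfl fun z hz => ?_
  have hz' : f^[n] z = x := by simpa using hz
  rw [Finset.mul_sum]
  refine Finset.sum_congr ?_ ?_
  · ext y
    simp only [Finset.mem_filter, Set.Finite.mem_toFinset, mem_preimage, mem_singleton_iff]
    constructor
    · exact fun h => h.2
    · intro h
      refine ⟨?_, h⟩
      rw [Function.iterate_add_apply, h, hz']
  · intro y hy
    have hy' : f^[m] y = z := by simpa using hy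
    rw [birkhoff_add, hy', Real.exp_add]
    ring

lemma treeSum_eq (n : ℕ) (x : X) : treeSum f φ n x = TT f hfin φ n (fun _ => 1) x := by
  unfold treeSum TT
  have : Fintype ↑(f^[n] ⁻¹' {x}) := (hfin n x).fintype
  rw [tsum_fintype]
  simp only [mul_one]
  exact (Finset.sum_subtype (hfin n x).toFinset (p := fun y => y ∈ f^[n] ⁻¹' {x})
    (fun y => by simp) (fun y => Real.exp (birkhoffSum' f φ n y))).symm

lemma TT_shift (P : ℝ) (n : ℕ) (g : X → ℝ) (x : X) :
    TT f hfin (fun y => φ y - P) n g x = Real.exp (-(n * P)) * TT f hfin φ n g x := by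
  simp only [TT, Finset.mul_sum]
  refine Finset.sum_congr rfl fun y _ => ?_
  have : birkhoffSum' f (fun y => φ y - P) n y = -(n * P) + birkhoffSum' f φ n y := by
    simp [birkhoffSum', Finset.sum_sub_distrib]; ring
  rw [this, Real.exp_add]; ring
end

section
variable {X : Type*} [MetricSpace X] {f : X → X} {lam ρ : ℝ}

lemma GSys.Z_pos (S : GSys f lam ρ) (φ : X → ℝ) (n : ℕ) (x : X) :
    0 < TT f S.fin φ n (fun _ => 1) x := by
  obtain ⟨y, hy⟩ := S.surj.iterate n x
  have := TT_single_le (hfin := S.fin) (φ := φ) n (g := fun _ => 1) (fun _ => zero_le_one) x y hy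
  exact lt_of_lt_of_le (by positivity) this

lemma GSys.Z_dist (S : GSys f lam ρ) {φ : X → ℝ} {K : ℝ}
    (hK : ∀ (n : ℕ) (x y : X), (∀ j ≤ n, dist (f^[j] x) (f^[j] y) ≤ ρ) →
      |birkhoffSum' f φ n x - birkhoffSum' f φ n y| ≤ K) (n : ℕ) (x y : X) (hxy : dist x y < ρ) :
    TT f S.fin φ n (fun _ => 1) x ≤ Real.exp K * TT f S.fin φ n (fun _ => 1) y := by
  have hb : ∀ u : X, ∃ w, f^[n] u = x →
      (∀ j ≤ n, dist (f^[j] u) (f^[j] w) ≤ dist x y) ∧ f^[n] w = y := by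
    intro u
    by_cases hu : f^[n] u = x
    · obtain ⟨w, hw⟩ := S.bowen_branch n u y (by rwa [hu])
      rw [hu] at hw
      exact ⟨w, fun _ => hw⟩
    · exact ⟨u, fun h => absurd h hu⟩
  choose i hi using hb
  classical
  rw [← TT_const]
  unfold TT
  have hinj : Set.InjOn i ((S.fin n x).toFinset : Set X) := by
    intro u hu v hv huv
    have hu' : f^[n] u = x := by simpa using hu
    have hv' : f^[n] v = x := by simpa using hv
    refine S.bowen_inj n u v (fun j hj => ?_) (hu'.trans hv'.symm)
    have h1 := (hi u hu').1 j hj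
    have h2 := (hi v hv').1 j hj
    rw [← huv] at h2
    have := dist_triangle_right (f^[j] u) (f^[j] v) (f^[j] (i u))
    linarith
  calc _ ≤ ∑ u ∈ (S.fin n x).toFinset, Real.exp (birkhoffSum' f φ n (i u)) * Real.exp K := by
        refine Finset.sum_le_sum fun u hu => ?_
        have hu' : f^[n] u = x := by simpa using hu
        rw [mul_one, ← Real.exp_add, Real.exp_le_exp]
        have := hK n u (i u) (fun j hj => ((hi u hu').1 j hj).trans hxy.le)
        have := (abs_le.1 this).2
        linarith
    _ = ∑ w ∈ (S.fin n x).toFinset.image i, Real.exp (birkhoffSum' f φ n w) * Real.exp K := by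
        rw [Finset.sum_image hinj]
    _ ≤ _ := by
        refine Finset.sum_le_sum_of_subset_of_nonneg ?_ (fun _ _ _ => by positivity)
        intro w hw
        obtain ⟨u, hu, rfl⟩ := Finset.mem_image.1 hw
        have hu' : f^[n] u = x := by simpa using hu
        simpa using (hi u hu').2

lemma GSys.Z_bdd [CompactSpace X] (S : GSys f lam ρ) {φ : X → ℝ} {K : ℝ}
    (hK : ∀ (n : ℕ) (x y : X), (∀ j ≤ n, dist (f^[j] x) (f^[j] y) ≤ ρ) →
      |birkhoffSum' f φ n x - birkhoffSum' f φ n y| ≤ K) (n : ℕ) :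
    ∃ B : ℝ, ∀ x, TT f S.fin φ n (fun _ => 1) x ≤ B := by
  have := (isCompact_univ (X := X)).induction_on
    (p := fun A => ∃ B : ℝ, ∀ x ∈ A, TT f S.fin φ n (fun _ => 1) x ≤ B) ⟨0, by simp⟩
    (by
      rintro A B hst ⟨ξ, h⟩
      exact ⟨ξ, fun x hx => h x (hst hx)⟩)
    (by
      rintro A B ⟨ξ, h⟩ ⟨ξ', h'⟩
      refine ⟨max ξ ξ', ?_⟩
      rintro q (hq | hq)
      · exact (h q hq).trans (le_max_left _ _)
      · exact (h' q hq).trans (le_max_right _ _))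
    (by
      intro x _
      refine ⟨ball x ρ, ?_, _, fun y hy => S.Z_dist hK n y x hy⟩
      rw [nhdsWithin_univ]
      exact ball_mem_nhds _ S.pos)
  obtain ⟨B, h⟩ := this
  exact ⟨B, fun x => h x (mem_univ x)⟩

lemma birk_ge {X : Type*} {f : X → X} {φ : X → ℝ} {F : ℝ} (hF : ∀ x, |φ x| ≤ F) (n : ℕ) (x : X) :
    -(n * F) ≤ birkhoffSum' f φ n x := by
  have : ∑ j ∈ Finset.range n, (-F) ≤ birkhoffSum' f φ n x :=
    Finset.sum_le_sum fun j _ => (abs_le.1 (hF _)).1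
  simpa using this

lemma holder_bdd [CompactSpace X] {φ : X → ℝ} (hφ : HolderPotential φ) :
    ∃ F : ℝ, 0 ≤ F ∧ ∀ x, |φ x| ≤ F := by
  obtain ⟨C, hC, b, ⟨hb, -⟩, h⟩ := hφ
  rcases isEmpty_or_nonempty X with he | ⟨⟨x0⟩⟩
  · exact ⟨0, le_rfl, fun x => he.elim x⟩
  · refine ⟨|φ x0| + C * Metric.diam (univ : Set X) ^ b,
      add_nonneg (abs_nonneg _) (mul_nonneg hC.le (Real.rpow_nonneg Metric.diam_nonneg _)),
      fun x => ?_⟩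
    have h1 := h x x0
    have h2 : dist x x0 ≤ Metric.diam (univ : Set X) :=
      Metric.dist_le_diam_of_mem isCompact_univ.isBounded (mem_univ _) (mem_univ _)
    have h3 : C * dist x x0 ^ b ≤ C * Metric.diam (univ : Set X) ^ b := by gcongr
    have h4 := abs_add_le (φ x - φ x0) (φ x0)
    rw [sub_add_cancel] at h4
    linarith

lemma GSys.Z_compare [CompactSpace X] (S : GSys f lam ρ) (htrans : TopologicallyTransitive f)
    {φ : X → ℝ} (hφ : HolderPotential φ) :
    ∃ A : ℝ, 1 ≤ A ∧ ∀ (n : ℕ) (x y : X),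
      TT f S.fin φ n (fun _ => 1) x ≤ A * TT f S.fin φ n (fun _ => 1) y := by
  obtain ⟨K, hK0, hK⟩ := S.distortion hφ
  obtain ⟨F, hF0, hF⟩ := holder_bdd hφ
  obtain ⟨M, hM⟩ := S.reach htrans ρ S.pos le_rfl
  choose B hB using S.Z_bdd hK
  set B' := 1 + ∑ k ∈ Finset.range (M + 1), |B k| with hB'
  have hBk : ∀ k ≤ M, ∀ x, TT f S.fin φ k (fun _ => 1) x ≤ B' := by
    intro k hk x
    have h1 : |B k| ≤ ∑ k ∈ Finset.range (M + 1), |B k| :=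
      Finset.single_le_sum (f := fun k => |B k|) (fun _ _ => abs_nonneg _)
        (Finset.mem_range.2 (by omega))
    linarith [hB k x, le_abs_self (B k)]
  have hB1 : 1 ≤ B' := by
    have : 0 ≤ ∑ k ∈ Finset.range (M + 1), |B k| := Finset.sum_nonneg fun _ _ => abs_nonneg _
    linarith
  refine ⟨B' * Real.exp (K + M * F), ?_, ?_⟩
  · have := Real.one_le_exp (x := K + M * F) (by positivity)
    nlinarith
  intro n x y
  obtain ⟨k, hk, w, hw, hwy⟩ := hM x y
  have h1 := S.Z_dist hK n x w hw
  have h2 := TT_single_le (hfin := S.fin) (φ := φ) k (g := TT f S.fin φ n (fun _ => 1))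
    (fun u => (S.Z_pos φ n u).le) y w hwy
  rw [← TT_add, Nat.add_comm, TT_add] at h2
  have h3 : TT f S.fin φ n (TT f S.fin φ k fun _ => 1) y ≤ B' * TT f S.fin φ n (fun _ => 1) y := by
    rw [← TT_const]
    exact TT_mono _ (hBk k hk) _
  have h4 : Real.exp (-(M * F)) ≤ Real.exp (birkhoffSum' f φ k w) := by
    rw [Real.exp_le_exp]
    refine le_trans ?_ (birk_ge hF k w)
    have : (k : ℝ) * F ≤ M * F := by gcongr
    linarith
  have h5 : Real.exp (-(M * F)) * TT f S.fin φ n (fun _ => 1) w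
      ≤ B' * TT f S.fin φ n (fun _ => 1) y :=
    (mul_le_mul_of_nonneg_right h4 (S.Z_pos φ n w).le).trans (h2.trans h3)
  have h6 : TT f S.fin φ n (fun _ => 1) w
      ≤ Real.exp (M * F) * (B' * TT f S.fin φ n (fun _ => 1) y) := by
    have := mul_le_mul_of_nonneg_left h5 (Real.exp_pos (M * F)).le
    rwa [← mul_assoc, ← Real.exp_add, add_neg_cancel, Real.exp_zero, one_mul] at this
  calc _ ≤ _ := h1
    _ ≤ Real.exp K * (Real.exp (M * F) * (B' * TT f S.fin φ n (fun _ => 1) y)) := by gcongr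
    _ = _ := by rw [Real.exp_add]; ring

lemma GSys.pressure [CompactSpace X] [Nonempty X] (S : GSys f lam ρ)
    (htrans : TopologicallyTransitive f) {φ : X → ℝ} (hφ : HolderPotential φ) :
    ∃ P D : ℝ, 1 ≤ D ∧ ∀ (n : ℕ) (x : X),
      D⁻¹ ≤ Real.exp (-(n * P)) * TT f S.fin φ n (fun _ => 1) x ∧
      Real.exp (-(n * P)) * TT f S.fin φ n (fun _ => 1) x ≤ D := by
  obtain ⟨A, hA1, hA⟩ := S.Z_compare htrans hφ
  obtain ⟨F, hF0, hF⟩ := holder_bdd hφ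
  obtain ⟨x0⟩ := ‹Nonempty X›
  set Z : ℕ → ℝ := fun n => TT f S.fin φ n (fun _ => 1) x0 with hZ
  have hZp : ∀ n, 0 < Z n := fun n => S.Z_pos φ n x0
  have hA0 : 0 < A := by linarith
  set a : ℕ → ℝ := fun n => Real.log (Z n) with ha
  have hea : ∀ n, Real.exp (a n) = Z n := fun n => Real.exp_log (hZp n)
  set L := Real.log A with hL
  have hL0 : 0 ≤ L := Real.log_nonneg hA1
  have hup : ∀ m n, a (m + n) ≤ a m + a n + L := by
    intro m n
    have h1 : Z (m + n) ≤ Z m * Z n * A := by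
      simp only [hZ]
      rw [TT_add]
      refine (TT_mono m (fun y => hA n y x0) x0).trans ?_
      rw [TT_const]
      exact le_of_eq (by ring)
    have := Real.log_le_log (hZp _) h1
    rwa [Real.log_mul (mul_pos (hZp _) (hZp _)).ne' hA0.ne', Real.log_mul (hZp _).ne' (hZp _).ne']
      at this
  have hlo : ∀ m n, a m + a n - L ≤ a (m + n) := by
    intro m n
    have h1 : Z m * Z n ≤ Z (m + n) * A := by
      simp only [hZ]
      rw [TT_add]
      have := TT_mono (hfin := S.fin) (φ := φ) m (g := fun _ => Z n)
        (h := fun y => A * TT f S.fin φ n (fun _ => 1) y) (fun y => hA n x0 y) x0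
      rw [TT_const, TT_mul] at this
      simp only [hZ] at this
      linarith
    have := Real.log_le_log (mul_pos (hZp _) (hZp _)) h1
    rw [Real.log_mul (hZp _).ne' hA0.ne', Real.log_mul (hZp _).ne' (hZp _).ne'] at this
    simp only [ha]
    linarith
  have hu : Subadditive (fun n => a n + L) := fun m n => by
    have := hup m n
    simp only
    linarith
  have hv : Subadditive (fun n => - a n + L) := fun m n => by
    have := hlo m n
    simp only
    linarith
  have hab : ∀ n : ℕ, -(n * F) ≤ a n := by
    intro n
    obtain ⟨y, hy⟩ := S.surj.iterate n x0
    have h1 := TT_single_le (hfin := S.fin) (φ := φ) n (g := fun _ => 1)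
      (fun _ => zero_le_one) x0 y hy
    rw [mul_one] at h1
    have h2 := birk_ge (f := f) hF n y
    exact h2.trans ((Real.le_log_iff_exp_le (hZp n)).2 h1)
  have hbu : BddBelow (range fun n : ℕ => (a n + L) / n) := by
    refine ⟨-F, ?_⟩
    rintro _ ⟨n, rfl⟩
    rcases Nat.eq_zero_or_pos n with rfl | hn
    · simpa using hF0
    · have hn' : (0 : ℝ) < n := by exact_mod_cast hn
      simp only
      rw [le_div_iff₀ hn']
      linarith [hab n]
  have htu := hu.tendsto_lim hbu
  set P := hu.lim with hP
  have hLn : Tendsto (fun n : ℕ => 2 * L / (n : ℝ)) atTop (nhds 0) :=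
    tendsto_const_div_atTop_nhds_zero_nat _
  have htv : Tendsto (fun n : ℕ => (-a n + L) / n) atTop (nhds (-P)) := by
    have := hLn.sub htu
    rw [zero_sub] at this
    refine this.congr fun n => ?_
    rw [← sub_div]
    congr 1
    ring
  have hbv := htv.bddBelow_range
  have hvl : hv.lim = -P := tendsto_nhds_unique (hv.tendsto_lim hbv) htv
  have h1 : ∀ n : ℕ, n * P ≤ a n + L := by
    intro n
    rcases Nat.eq_zero_or_pos n with rfl | hn
    · have := hlo 0 0
      have := hup 0 0
      simp only [add_zero] at *
      push_cast
      linarith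
    · have hn' : (0 : ℝ) < n := by exact_mod_cast hn
      have := hu.lim_le_div hbu hn.ne'
      rw [le_div_iff₀ hn'] at this
      linarith
  have h2 : ∀ n : ℕ, a n - L ≤ n * P := by
    intro n
    rcases Nat.eq_zero_or_pos n with rfl | hn
    · have := hlo 0 0
      have := hup 0 0
      simp only [add_zero] at *
      push_cast
      linarith
    · have hn' : (0 : ℝ) < n := by exact_mod_cast hn
      have := hv.lim_le_div hbv hn.ne'
      rw [le_div_iff₀ hn', hvl] at this
      linarith
  have heL : Real.exp L = A := Real.exp_log hA0
  refine ⟨P, A * A, by nlinarith, fun n x => ⟨?_, ?_⟩⟩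
  · have h3 : A⁻¹ ≤ Real.exp (-(n * P)) * Z n := by
      rw [← hea, ← heL, ← Real.exp_neg, ← Real.exp_add, Real.exp_le_exp]
      linarith [h1 n]
    have h4 := mul_le_mul_of_nonneg_left (hA n x0 x) (Real.exp_pos (-(n * P))).le
    rw [mul_inv, inv_mul_le_iff₀ hA0]
    simp only [hZ] at h3
    linarith
  · have h3 : Real.exp (-(n * P)) * Z n ≤ A := by
      rw [← hea, ← heL, ← Real.exp_add, Real.exp_le_exp]
      linarith [h2 n]
    have h4 := mul_le_mul_of_nonneg_left (hA n x x0) (Real.exp_pos (-(n * P))).le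
    have h5 := mul_le_mul_of_nonneg_left h3 hA0.le
    simp only [hZ] at h5
    linarith
end

section
variable {X : Type*} [MetricSpace X] {f : X → X} {lam ρ : ℝ}

lemma exists_discrete_measure [CompactSpace X] [MeasurableSpace X] [BorelSpace X]
    {ι : Type*} (s : Finset ι) (w : ι → ℝ) (p : ι → X)
    (hw : ∀ i ∈ s, 0 ≤ w i) (h1 : ∑ i ∈ s, w i = 1) :
    ∃ ν : ProbabilityMeasure X, ∀ g : X → ℝ, Continuous g →
      ∫ x, g x ∂(ν : Measure X) = ∑ i ∈ s, w i * g (p i) := by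
  set m : Measure X := ∑ i ∈ s, ENNReal.ofReal (w i) • Measure.dirac (p i) with hm
  have hp : IsProbabilityMeasure m := by
    constructor
    simp only [hm, Measure.finsetSum_apply, Measure.smul_apply, measure_univ, smul_eq_mul, mul_one]
    rw [← ENNReal.ofReal_sum_of_nonneg hw, h1, ENNReal.ofReal_one]
  refine ⟨⟨m, hp⟩, fun g hg => ?_⟩
  show ∫ x, g x ∂m = _
  rw [hm, integral_finsetSum_measure]
  · refine Finset.sum_congr rfl fun i hi => ?_
    rw [integral_smul_measure, integral_dirac, ENNReal.toReal_ofReal (hw i hi), smul_eq_mul]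
  · intro i hi
    refine Integrable.smul_measure ?_ ENNReal.ofReal_ne_top
    exact hg.integrable_of_hasCompactSupport (HasCompactSupport.of_compactSpace g)

/-- The averaged functionals. -/
noncomputable def Lam (S : GSys f lam ρ) (φ : X → ℝ) (x0 : X) (N : ℕ) (g : X → ℝ) : ℝ :=
  (N * TT f S.fin φ N (fun _ => 1) x0)⁻¹ *
    ∑ k ∈ Finset.range N, TT f S.fin φ N (fun y => g (f^[k] y)) x0

lemma Lam_measure [CompactSpace X] [MeasurableSpace X] [BorelSpace X]
    (S : GSys f lam ρ) (φ : X → ℝ) (x0 : X) (N : ℕ) :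
    ∃ ν : ProbabilityMeasure X, ∀ g : X → ℝ, Continuous g →
      ∫ x, g x ∂(ν : Measure X) = Lam S φ x0 (N + 1) g := by
  have hZ := S.Z_pos φ (N + 1) x0
  set Z := TT f S.fin φ (N + 1) (fun _ => 1) x0 with hZd
  have hN : (0 : ℝ) < ((N + 1 : ℕ) : ℝ) := by positivity
  obtain ⟨ν, hν⟩ := exists_discrete_measure
    (Finset.range (N + 1) ×ˢ (S.fin (N + 1) x0).toFinset)
    (fun q => (((N + 1 : ℕ) : ℝ) * Z)⁻¹ * Real.exp (birkhoffSum' f φ (N + 1) q.2))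
    (fun q => f^[q.1] q.2) (fun q _ => by positivity) (by
      rw [Finset.sum_product]
      simp only [Finset.sum_const, Finset.card_range, ← Finset.mul_sum, nsmul_eq_mul]
      have : ∑ i ∈ (S.fin (N + 1) x0).toFinset, Real.exp (birkhoffSum' f φ (N + 1) i) = Z := by
        simp [hZd, TT]
      rw [this]
      field_simp)
  refine ⟨ν, fun g hg => ?_⟩
  rw [hν g hg, Finset.sum_product, Lam, Finset.mul_sum]
  refine Finset.sum_congr rfl fun k _ => ?_
  rw [← hZd, TT, Finset.mul_sum]
  refine Finset.sum_congr rfl fun y _ => ?_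
  ring

lemma exists_limit [CompactSpace X] [MeasurableSpace X] [BorelSpace X]
    (S : GSys f lam ρ) (φ : X → ℝ) (x0 : X) (hf : Continuous f) :
    ∃ μ : Measure X, IsProbabilityMeasure μ ∧ (∀ E : Set X, MeasurableSet E → μ (f ⁻¹' E) = μ E) ∧
      ∃ u : Filter ℕ, u.NeBot ∧ u ≤ atTop ∧ ∀ g : X → ℝ, Continuous g →
        Tendsto (fun N => Lam S φ x0 (N + 1) g) u (nhds (∫ x, g x ∂μ)) := by
  choose ν hν using Lam_measure S φ x0
  obtain ⟨μ, -, hμ⟩ := isCompact_univ.ultrafilter_le_nhds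
    ((Filter.hyperfilter ℕ).map ν) (by simp)
  have hcv : ∀ g : X → ℝ, Continuous g →
        Tendsto (fun N => Lam S φ x0 (N + 1) g) (Filter.hyperfilter ℕ)
          (nhds (∫ x, g x ∂(μ : Measure X))) := by
    intro g hg
    have ht : Tendsto ν (Filter.hyperfilter ℕ : Filter ℕ) (nhds μ) := hμ
    rw [ProbabilityMeasure.tendsto_iff_forall_integral_tendsto] at ht
    have := ht (BoundedContinuousFunction.mkOfCompact ⟨g, hg⟩)
    simp only [BoundedContinuousFunction.mkOfCompact_apply, ContinuousMap.coe_mk] at this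
    exact this.congr fun N => hν N g hg
  have hle : (Filter.hyperfilter ℕ : Filter ℕ) ≤ atTop := Nat.hyperfilter_le_atTop
  refine ⟨μ, inferInstance, ?_, Filter.hyperfilter ℕ, inferInstance, hle, hcv⟩
  have hinv : Measure.map f (μ : Measure X) = μ := by
    have : IsProbabilityMeasure (Measure.map f (μ : Measure X)) :=
      Measure.isProbabilityMeasure_map hf.aemeasurable
    refine ext_of_forall_integral_eq_of_IsFiniteMeasure fun g => ?_
    rw [integral_map hf.aemeasurable g.continuous.aestronglyMeasurable]
    have h1 := (hcv (fun x => g (f x)) (g.continuous.comp hf)).sub (hcv g g.continuous)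
    have h2 : Tendsto (fun N : ℕ => 2 * ‖g‖ / ((N : ℝ) + 1)) (Filter.hyperfilter ℕ) (nhds 0) := by
      have := (tendsto_const_div_atTop_nhds_zero_nat (2 * ‖g‖)).comp (tendsto_add_atTop_nat 1)
      refine (this.mono_left hle).congr fun n => ?_
      simp
    have h3 := squeeze_zero_norm (f := fun N => Lam S φ x0 (N + 1) (fun x => g (f x)) -
      Lam S φ x0 (N + 1) g) (fun N => ?_) h2
    · exact sub_eq_zero.1 (tendsto_nhds_unique h1 h3)
    · have hZ := S.Z_pos φ (N + 1) x0
      simp only [Lam]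
      set Z := TT f S.fin φ (N + 1) (fun _ => 1) x0 with hZd
      have hT : ∀ h : X → X, |TT f S.fin φ (N + 1) (fun y => g (h y)) x0| ≤ ‖g‖ * Z := by
        intro h
        rw [abs_le]
        constructor
        · rw [← neg_mul, hZd, ← TT_const]
          exact TT_mono _ (fun y => (abs_le.1 (g.norm_coe_le_norm (h y))).1) _
        · rw [hZd, ← TT_const]
          exact TT_mono _ (fun y => (abs_le.1 (g.norm_coe_le_norm (h y))).2) _
      rw [← mul_sub, ← Finset.sum_sub_distrib]
      have htel := Finset.sum_range_sub
        (fun k => TT f S.fin φ (N + 1) (fun y => g (f^[k] y)) x0) (N + 1)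
      simp only [Function.iterate_succ_apply'] at htel
      rw [htel, Real.norm_eq_abs, abs_mul]
      have hN : (0 : ℝ) < ((N + 1 : ℕ) : ℝ) := by positivity
      rw [abs_of_pos (by positivity), inv_mul_le_iff₀ (by positivity)]
      have e1 := hT (fun y => f (f^[N] y))
      have e2 := hT (fun y => f^[0] y)
      have e3 := abs_sub (TT f S.fin φ (N + 1) (fun y => g (f (f^[N] y))) x0)
        (TT f S.fin φ (N + 1) (fun y => g (f^[0] y)) x0)
      refine (e3.trans (add_le_add e1 e2)).trans (le_of_eq ?_)
      push_cast
      field_simp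
      ring
  intro E hE
  rw [← Measure.map_apply hf.measurable hE, hinv]

lemma Lam_bounds (S : GSys f lam ρ) {φ : X → ℝ} {D : ℝ} (hD : 1 ≤ D)
    (hZ : ∀ (n : ℕ) (x : X), D⁻¹ ≤ TT f S.fin φ n (fun _ => 1) x ∧
      TT f S.fin φ n (fun _ => 1) x ≤ D) (x0 : X) (N : ℕ) (g : X → ℝ) (hg : ∀ x, 0 ≤ g x) :
    (D * D)⁻¹ * ((N + 1 : ℝ)⁻¹ * ∑ j ∈ Finset.range (N + 1), TT f S.fin φ (j + 1) g x0) ≤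
      Lam S φ x0 (N + 1) g ∧
    Lam S φ x0 (N + 1) g ≤
      (D * D) * ((N + 1 : ℝ)⁻¹ * ∑ j ∈ Finset.range (N + 1), TT f S.fin φ (j + 1) g x0) := by
  have hD0 : 0 < D := by linarith
  have hkey : ∀ k ∈ Finset.range (N + 1), TT f S.fin φ (N + 1) (fun y => g (f^[k] y)) x0 =
      TT f S.fin φ (N + 1 - 1 - k + 1) (fun z => g z * TT f S.fin φ k (fun _ => 1) z) x0 := by
    intro k hk
    have hk' := Finset.mem_range.1 hk
    have : N + 1 = (N + 1 - 1 - k + 1) + k := by omega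
    conv_lhs => rw [this]
    rw [TT_add]
    congr 1
    funext z
    exact TT_comp k g z
  have hsum : ∑ k ∈ Finset.range (N + 1), TT f S.fin φ (N + 1 - 1 - k + 1) g x0 =
      ∑ j ∈ Finset.range (N + 1), TT f S.fin φ (j + 1) g x0 :=
    Finset.sum_range_reflect (fun j => TT f S.fin φ (j + 1) g x0) (N + 1)
  have hlo : D⁻¹ * ∑ j ∈ Finset.range (N + 1), TT f S.fin φ (j + 1) g x0 ≤
      ∑ k ∈ Finset.range (N + 1), TT f S.fin φ (N + 1) (fun y => g (f^[k] y)) x0 := by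
    rw [← hsum, Finset.mul_sum]
    refine Finset.sum_le_sum fun k hk => ?_
    rw [hkey k hk, ← TT_mul]
    refine TT_mono _ (fun z => ?_) _
    rw [mul_comm]
    exact mul_le_mul_of_nonneg_left (hZ k z).1 (hg z)
  have hup : ∑ k ∈ Finset.range (N + 1), TT f S.fin φ (N + 1) (fun y => g (f^[k] y)) x0 ≤
      D * ∑ j ∈ Finset.range (N + 1), TT f S.fin φ (j + 1) g x0 := by
    rw [← hsum, Finset.mul_sum]
    refine Finset.sum_le_sum fun k hk => ?_
    rw [hkey k hk, ← TT_mul]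
    refine TT_mono _ (fun z => ?_) _
    rw [mul_comm]
    exact mul_le_mul_of_nonneg_right (hZ k z).2 (hg z)
  have hs0 : 0 ≤ ∑ j ∈ Finset.range (N + 1), TT f S.fin φ (j + 1) g x0 :=
    Finset.sum_nonneg fun j _ => TT_nonneg _ hg _
  obtain ⟨z1, z2⟩ := hZ (N + 1) x0
  have zp := S.Z_pos φ (N + 1) x0
  unfold Lam
  generalize TT f S.fin φ (N + 1) (fun _ => 1) x0 = Z at *
  generalize ∑ j ∈ Finset.range (N + 1), TT f S.fin φ (j + 1) g x0 = s at *
  generalize ∑ k ∈ Finset.range (N + 1), TT f S.fin φ (N + 1) (fun y => g (f^[k] y)) x0 = t at *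
  have hzi1 : D⁻¹ ≤ Z⁻¹ := inv_anti₀ zp z2
  have hzi2 : Z⁻¹ ≤ D := by
    have := inv_anti₀ (by positivity) z1
    rwa [inv_inv] at this
  have ht0 : 0 ≤ t := le_trans (by positivity) hlo
  push_cast
  rw [mul_inv, mul_inv]
  constructor
  · calc D⁻¹ * D⁻¹ * ((N + 1 : ℝ)⁻¹ * s) = (N + 1 : ℝ)⁻¹ * D⁻¹ * (D⁻¹ * s) := by ring
      _ ≤ (N + 1 : ℝ)⁻¹ * Z⁻¹ * t := by gcongr
  · calc (N + 1 : ℝ)⁻¹ * Z⁻¹ * t ≤ (N + 1 : ℝ)⁻¹ * D * (D * s) := by gcongr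
      _ = _ := by ring
end

section
variable {X : Type*} [MetricSpace X] {f : X → X} {lam ρ : ℝ}

/-- indicator function of a Bowen ball -/
noncomputable def bInd (f : X → X) (n : ℕ) (x : X) (s : ℝ) : X → ℝ :=
  (bowenBall f n x s).indicator (fun _ => 1)

lemma bInd_nonneg (n : ℕ) (x : X) (s : ℝ) (y : X) : 0 ≤ bInd f n x s y :=
  Set.indicator_nonneg (fun _ _ => zero_le_one) y

lemma bInd_le_one (n : ℕ) (x : X) (s : ℝ) (y : X) : bInd f n x s y ≤ 1 :=
  Set.indicator_le' (fun _ _ => le_rfl) (fun _ _ => zero_le_one) y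

lemma GSys.bInd_upper (S : GSys f lam ρ) {φ : X → ℝ} {K : ℝ}
    (hK : ∀ (n : ℕ) (x y : X), (∀ j ≤ n, dist (f^[j] x) (f^[j] y) ≤ ρ) →
      |birkhoffSum' f φ n x - birkhoffSum' f φ n y| ≤ K) (n : ℕ) (x z : X) :
    TT f S.fin φ n (bInd f n x ρ) z ≤ Real.exp (birkhoffSum' f φ n x + K) := by
  classical
  by_cases h : ∃ y, f^[n] y = z ∧ y ∈ bowenBall f n x ρ
  · obtain ⟨y, hy, hyb⟩ := h
    unfold TT
    rw [Finset.sum_eq_single y]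
    · have h1 := hK n x y (fun j hj => (hyb j hj).le)
      have h2 := (abs_le.1 h1).1
      calc _ ≤ Real.exp (birkhoffSum' f φ n y) * 1 :=
            mul_le_mul_of_nonneg_left (bInd_le_one _ _ _ _) (Real.exp_pos _).le
        _ ≤ _ := by
            rw [mul_one, Real.exp_le_exp]
            linarith
    · intro v hv hvy
      have hv' : f^[n] v = z := by simpa using hv
      have : v ∉ bowenBall f n x ρ := by
        intro hvb
        apply hvy
        refine S.bowen_inj n v y (fun j hj => ?_) (hv'.trans hy.symm)
        have h1 := hvb j hj
        have h2 := hyb j hj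
        have := dist_triangle_left (f^[j] v) (f^[j] y) (f^[j] x)
        linarith
      rw [bInd, Set.indicator_of_notMem this, mul_zero]
    · intro hy'
      exact absurd (by simpa using hy) hy'
  · have : TT f S.fin φ n (bInd f n x ρ) z = 0 := by
      refine Finset.sum_eq_zero fun v hv => ?_
      have hv' : f^[n] v = z := by simpa using hv
      rw [bInd, Set.indicator_of_notMem (fun hb => h ⟨v, hv', hb⟩), mul_zero]
    rw [this]
    positivity

lemma GSys.bInd_lower (S : GSys f lam ρ) {φ : X → ℝ} {K : ℝ}
    (hK : ∀ (n : ℕ) (x y : X), (∀ j ≤ n, dist (f^[j] x) (f^[j] y) ≤ ρ) →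
      |birkhoffSum' f φ n x - birkhoffSum' f φ n y| ≤ K) {s : ℝ} (hs : s ≤ ρ)
    (n : ℕ) (x z : X) :
    Real.exp (birkhoffSum' f φ n x - K) * bInd f 0 (f^[n] x) s z ≤
      TT f S.fin φ n (bInd f n x s) z := by
  by_cases hz : z ∈ bowenBall f 0 (f^[n] x) s
  · have hd : dist (f^[n] x) z < s := hz 0 le_rfl
    obtain ⟨y, hy, hyz⟩ := S.bowen_branch n x z (hd.trans_le hs)
    have hyb : y ∈ bowenBall f n x s := fun j hj => (hy j hj).trans_lt hd
    have h1 := TT_single_le (hfin := S.fin) (φ := φ) n (g := bInd f n x s)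
      (bInd_nonneg n x s) z y hyz
    refine le_trans ?_ h1
    rw [bInd, bInd, Set.indicator_of_mem hz, Set.indicator_of_mem hyb, mul_one, mul_one,
      Real.exp_le_exp]
    have := (abs_le.1 (hK n x y (fun j hj => (hyb j hj).le.trans hs))).2
    linarith
  · rw [bInd, Set.indicator_of_notMem hz, mul_zero]
    exact TT_nonneg _ (bInd_nonneg n x s) _

/-- upper bound for averages -/
lemma GSys.avg_upper (S : GSys f lam ρ) {φ : X → ℝ} {K : ℝ}
    (hK : ∀ (n : ℕ) (x y : X), (∀ j ≤ n, dist (f^[j] x) (f^[j] y) ≤ ρ) →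
      |birkhoffSum' f φ n x - birkhoffSum' f φ n y| ≤ K) {D : ℝ} (hD : 1 ≤ D)
    (hZ : ∀ (n : ℕ) (x : X), TT f S.fin φ n (fun _ => 1) x ≤ D)
    (n : ℕ) (x x0 : X) (N : ℕ) :
    ∑ j ∈ Finset.range N, TT f S.fin φ (j + 1) (bInd f n x ρ) x0 ≤
      n * D + N * (D * Real.exp (birkhoffSum' f φ n x + K)) := by
  have h1 : ∀ i, TT f S.fin φ i (bInd f n x ρ) x0 ≤ D := fun i =>
    (TT_mono i (bInd_le_one n x ρ) x0).trans (hZ i x0)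
  have h2 : ∀ i, n ≤ i → TT f S.fin φ i (bInd f n x ρ) x0 ≤
      D * Real.exp (birkhoffSum' f φ n x + K) := by
    intro i hi
    obtain ⟨k, rfl⟩ := Nat.exists_eq_add_of_le' hi
    rw [TT_add]
    refine (TT_mono k (fun z => S.bInd_upper hK n x z) x0).trans ?_
    rw [TT_const, mul_comm]
    exact mul_le_mul_of_nonneg_right (hZ k x0) (Real.exp_pos _).le
  have h3 : ∀ i ∈ Finset.range N, 0 ≤ TT f S.fin φ (i + 1) (bInd f n x ρ) x0 :=
    fun i _ => TT_nonneg _ (bInd_nonneg n x ρ) _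
  have hD0 : 0 < D := by linarith
  calc _ ≤ ∑ j ∈ Finset.range (n + N), TT f S.fin φ (j + 1) (bInd f n x ρ) x0 :=
        Finset.sum_le_sum_of_subset_of_nonneg
          (Finset.range_subset_range.2 (Nat.le_add_left N n))
          (fun i _ _ => TT_nonneg _ (bInd_nonneg n x ρ) _)
    _ = ∑ j ∈ Finset.range n, TT f S.fin φ (j + 1) (bInd f n x ρ) x0 +
        ∑ j ∈ Finset.range N, TT f S.fin φ (n + j + 1) (bInd f n x ρ) x0 :=
        Finset.sum_range_add _ _ _
    _ ≤ ∑ j ∈ Finset.range n, D +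
        ∑ j ∈ Finset.range N, D * Real.exp (birkhoffSum' f φ n x + K) := by
        gcongr with j hj j hj
        · exact h1 _
        · exact h2 _ (by omega)
    _ = _ := by simp

/-- lower bound for averages -/
lemma GSys.avg_lower (S : GSys f lam ρ) {φ : X → ℝ} {K F : ℝ}
    (hK : ∀ (n : ℕ) (x y : X), (∀ j ≤ n, dist (f^[j] x) (f^[j] y) ≤ ρ) →
      |birkhoffSum' f φ n x - birkhoffSum' f φ n y| ≤ K)
    (hF0 : 0 ≤ F) (hF : ∀ x, |φ x| ≤ F) {D : ℝ} (hD : 1 ≤ D)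
    (hZ : ∀ (n : ℕ) (x : X), D⁻¹ ≤ TT f S.fin φ n (fun _ => 1) x)
    {s : ℝ} (hs : s ≤ ρ) {M : ℕ} (hM : ∀ u z : X, ∃ k ≤ M, ∃ w, dist u w < s ∧ f^[k] w = z)
    (n : ℕ) (x x0 : X) (N : ℕ) :
    N * (Real.exp (birkhoffSum' f φ n x - K) * ((M + 1 : ℝ)⁻¹ * (Real.exp (-(M * F)) * D⁻¹))) ≤
      ∑ j ∈ Finset.range (n + M + N), TT f S.fin φ (j + 1) (bInd f n x s) x0 := by
  set b := bInd f 0 (f^[n] x) s with hb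
  have hb0 : ∀ y, 0 ≤ b y := bInd_nonneg _ _ _
  set c := Real.exp (-(M * F)) with hc
  have hc0 : 0 < c := Real.exp_pos _
  have h1 : ∀ z, c ≤ ∑ k ∈ Finset.range (M + 1), TT f S.fin φ k b z := by
    intro z
    obtain ⟨k, hk, w, hw, hwz⟩ := hM (f^[n] x) z
    have e1 := TT_single_le (hfin := S.fin) (φ := φ) k (g := b) hb0 z w hwz
    have hwb : w ∈ bowenBall f 0 (f^[n] x) s := by
      intro j hj
      obtain rfl : j = 0 := by omega
      exact hw
    have e2 : b w = 1 := Set.indicator_of_mem hwb _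
    rw [e2, mul_one] at e1
    have e3 := Finset.single_le_sum (s := Finset.range (M + 1)) (f := fun k => TT f S.fin φ k b z)
      (fun _ _ => TT_nonneg _ hb0 _) (Finset.mem_range.2 (Nat.lt_succ_of_le hk))
    refine le_trans ?_ (e1.trans e3)
    rw [hc, Real.exp_le_exp]
    refine le_trans ?_ (birk_ge hF k w)
    have : (k : ℝ) * F ≤ M * F := by gcongr
    linarith
  set a : ℕ → ℝ := fun j => TT f S.fin φ (j + 1) b x0 with ha
  have ha0 : ∀ j, 0 ≤ a j := fun j => TT_nonneg _ hb0 _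
  have h2 : ∀ i, c * D⁻¹ ≤ ∑ k ∈ Finset.range (M + 1), a (i + k) := by
    intro i
    have e1 := TT_mono (hfin := S.fin) (φ := φ) (i + 1) h1 x0
    rw [TT_const, TT_sum] at e1
    refine (mul_le_mul_of_nonneg_left (hZ (i + 1) x0) hc0.le).trans (e1.trans (le_of_eq ?_))
    refine Finset.sum_congr rfl fun k _ => ?_
    simp only [ha]
    rw [show i + k + 1 = i + 1 + k by ring, TT_add (i + 1) k]
  have h3 : N * (c * D⁻¹) ≤ (M + 1) * ∑ j ∈ Finset.range (M + N), a j := by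
    calc N * (c * D⁻¹) = ∑ i ∈ Finset.range N, c * D⁻¹ := by simp
      _ ≤ ∑ i ∈ Finset.range N, ∑ k ∈ Finset.range (M + 1), a (i + k) :=
          Finset.sum_le_sum fun i _ => h2 i
      _ = ∑ k ∈ Finset.range (M + 1), ∑ i ∈ Finset.range N, a (i + k) := Finset.sum_comm
      _ ≤ ∑ k ∈ Finset.range (M + 1), ∑ j ∈ Finset.range (M + N), a j := by
          refine Finset.sum_le_sum fun k hk => ?_
          have hk' := Finset.mem_range.1 hk
          calc ∑ i ∈ Finset.range N, a (i + k) ≤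
              ∑ j ∈ Finset.range k, a j + ∑ i ∈ Finset.range N, a (k + i) := by
                simp only [Nat.add_comm k]
                linarith [Finset.sum_nonneg (s := Finset.range k) (fun j _ => ha0 j)]
            _ = ∑ j ∈ Finset.range (k + N), a j := (Finset.sum_range_add _ _ _).symm
            _ ≤ _ := Finset.sum_le_sum_of_subset_of_nonneg
                (Finset.range_subset_range.2 (by omega)) (fun i _ _ => ha0 i)
      _ = _ := by simp
  have h4 : ∀ j, Real.exp (birkhoffSum' f φ n x - K) * a j ≤
      TT f S.fin φ (n + j + 1) (bInd f n x s) x0 := by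
    intro j
    simp only [ha]
    rw [← TT_mul, show n + j + 1 = j + 1 + n by ring, TT_add (j + 1) n]
    exact TT_mono _ (fun z => S.bInd_lower hK hs n x z) _
  have hM1 : (0 : ℝ) < M + 1 := by positivity
  have h5 : N * ((M + 1 : ℝ)⁻¹ * (c * D⁻¹)) ≤ ∑ j ∈ Finset.range (M + N), a j := by
    have := mul_le_mul_of_nonneg_left h3 (inv_pos.2 hM1).le
    rw [← mul_assoc _ (M + 1 : ℝ), inv_mul_cancel₀ hM1.ne', one_mul] at this
    linarith
  calc _ = Real.exp (birkhoffSum' f φ n x - K) * (N * ((M + 1 : ℝ)⁻¹ * (c * D⁻¹))) := by ring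
    _ ≤ Real.exp (birkhoffSum' f φ n x - K) * ∑ j ∈ Finset.range (M + N), a j := by gcongr
    _ = ∑ j ∈ Finset.range (M + N), Real.exp (birkhoffSum' f φ n x - K) * a j := Finset.mul_sum _ _ _
    _ ≤ ∑ j ∈ Finset.range (M + N), TT f S.fin φ (n + j + 1) (bInd f n x s) x0 :=
        Finset.sum_le_sum fun j _ => h4 j
    _ ≤ ∑ j ∈ Finset.range n, TT f S.fin φ (j + 1) (bInd f n x s) x0 +
        ∑ j ∈ Finset.range (M + N), TT f S.fin φ (n + j + 1) (bInd f n x s) x0 := by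
        have : 0 ≤ ∑ j ∈ Finset.range n, TT f S.fin φ (j + 1) (bInd f n x s) x0 :=
          Finset.sum_nonneg fun j _ => TT_nonneg _ (bInd_nonneg n x s) _
        linarith
    _ = ∑ j ∈ Finset.range (n + (M + N)), TT f S.fin φ (j + 1) (bInd f n x s) x0 :=
        (Finset.sum_range_add _ _ _).symm
    _ = _ := by rw [Nat.add_assoc]

lemma isOpen_bowen (hf : Continuous f) (n : ℕ) (x : X) (r : ℝ) : IsOpen (bowenBall f n x r) := by
  have : bowenBall f n x r = ⋂ j ∈ Finset.range (n + 1), {y | dist (f^[j] x) (f^[j] y) < r} := by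
    ext y
    simp [bowenBall]
  rw [this]
  refine isOpen_biInter_finset fun j _ => ?_
  exact isOpen_lt (continuous_const.dist (hf.iterate j)) continuous_const

lemma bump (hf : Continuous f) (n : ℕ) (x : X) {r s : ℝ} (hrs : r < s) :
    ∃ g : X → ℝ, Continuous g ∧ (∀ y, bInd f n x r y ≤ g y) ∧ (∀ y, g y ≤ bInd f n x s y) := by
  have hc : IsClosed {y | ∀ j ≤ n, dist (f^[j] x) (f^[j] y) ≤ r} := by
    have : {y | ∀ j ≤ n, dist (f^[j] x) (f^[j] y) ≤ r} =
        ⋂ j, ⋂ (_ : j ≤ n), {y | dist (f^[j] x) (f^[j] y) ≤ r} := by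
      ext y
      simp
    rw [this]
    refine isClosed_iInter fun j => isClosed_iInter fun _ => ?_
    exact isClosed_le (continuous_const.dist (hf.iterate j)) continuous_const
  obtain ⟨g, h0, h1, h01⟩ := exists_continuous_zero_one_of_isClosed
    (isOpen_bowen hf n x s).isClosed_compl hc (by
      rw [Set.disjoint_left]
      intro y hy hy'
      exact hy fun j hj => (hy' j hj).trans_lt hrs)
  refine ⟨g, g.continuous, fun y => ?_, fun y => ?_⟩
  · by_cases hy : y ∈ bowenBall f n x r
    · rw [h1 (fun j hj => (hy j hj).le)]
      exact bInd_le_one _ _ _ _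
    · rw [bInd, Set.indicator_of_notMem hy]
      exact (h01 y).1
  · by_cases hy : y ∈ bowenBall f n x s
    · rw [bInd, Set.indicator_of_mem hy]
      exact (h01 y).2
    · rw [h0 hy]
      exact bInd_nonneg _ _ _ _

lemma gibbs_core [CompactSpace X] [Nonempty X] [MeasurableSpace X] [BorelSpace X]
    (hf : Continuous f) (htrans : TopologicallyTransitive f)
    (S : GSys f lam ρ) {φ : X → ℝ} (hφ : HolderPotential φ) {D : ℝ} (hD : 1 ≤ D)
    (hZ : ∀ (n : ℕ) (x : X), D⁻¹ ≤ TT f S.fin φ n (fun _ => 1) x ∧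
      TT f S.fin φ n (fun _ => 1) x ≤ D) :
    ∃ c > (0 : ℝ), ∃ c' : ℝ, ∃ μ : Measure X, IsProbabilityMeasure μ ∧
      (∀ E : Set X, MeasurableSet E → μ (f ⁻¹' E) = μ E) ∧
      ∀ (x : X) (n : ℕ), c * Real.exp (birkhoffSum' f φ n x) ≤
        (μ (bowenBall f n x (ρ / 2))).toReal ∧
        (μ (bowenBall f n x (ρ / 2))).toReal ≤ c' * Real.exp (birkhoffSum' f φ n x) := by
  obtain ⟨K, hK0, hK⟩ := S.distortion hφ
  obtain ⟨F, hF0, hF⟩ := holder_bdd hφ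
  have hρ := S.pos
  obtain ⟨M, hM⟩ := S.reach htrans (ρ / 4) (by linarith) (by linarith)
  obtain ⟨x0⟩ := ‹Nonempty X›
  obtain ⟨μ, hμ, hinv, u, hu, hle, hcv⟩ := exists_limit S φ x0 hf
  have hD0 : 0 < D := by linarith
  refine ⟨(D * D)⁻¹ * (Real.exp (-K) * ((M + 1 : ℝ)⁻¹ * (Real.exp (-(M * F)) * D⁻¹))),
    by positivity, (D * D) * (D * Real.exp K), μ, hμ, hinv, fun x n => ?_⟩
  have hIntg : ∀ r, ∫ y, bInd f n x r y ∂μ = (μ (bowenBall f n x r)).toReal := by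
    intro r
    simp only [bInd]
    rw [integral_indicator_const _ (isOpen_bowen hf n x r).measurableSet]
    simp [Measure.real]
  have hbi : ∀ r, Integrable (bInd f n x r) μ := fun r =>
    (integrable_const (1 : ℝ)).indicator (isOpen_bowen hf n x r).measurableSet
  have hinv0 : ∀ C : ℝ, Tendsto (fun N : ℕ => C / ((N : ℝ) + 1)) u (nhds 0) := by
    intro C
    have := (tendsto_const_div_atTop_nhds_zero_nat C).comp (tendsto_add_atTop_nat 1)
    refine (this.mono_left hle).congr fun n => ?_
    simp
  constructor
  · obtain ⟨g, hg, hg1, hg2⟩ := bump hf n x (show ρ / 4 < ρ / 2 by linarith)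
    have hg0 : ∀ y, 0 ≤ g y := fun y => (bInd_nonneg _ _ _ _).trans (hg1 y)
    have hgi : Integrable g μ :=
      hg.integrable_of_hasCompactSupport (HasCompactSupport.of_compactSpace g)
    rw [← hIntg]
    refine le_trans ?_ (integral_mono hgi (hbi _) hg2)
    set Q := Real.exp (birkhoffSum' f φ n x - K) *
      ((M + 1 : ℝ)⁻¹ * (Real.exp (-(M * F)) * D⁻¹)) with hQ
    have hlim : Tendsto (fun N : ℕ => (D * D)⁻¹ * (Q - ((n + M) * Q) / ((N : ℝ) + 1))) u
        (nhds ((D * D)⁻¹ * (Q - 0))) :=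
      ((hinv0 ((n + M) * Q)).const_sub Q).const_mul _
    have hev : ∀ᶠ N : ℕ in u, (D * D)⁻¹ * (Q - ((n + M) * Q) / ((N : ℝ) + 1)) ≤
        Lam S φ x0 (N + 1) g := by
      filter_upwards [hle (eventually_ge_atTop (n + M))] with N hN
      refine le_trans ?_ (Lam_bounds S hD hZ x0 N g hg0).1
      have h1 := S.avg_lower hK hF0 hF hD (fun n x => (hZ n x).1) (by linarith) hM n x x0
        (N + 1 - (n + M))
      have hN' : n + M + (N + 1 - (n + M)) = N + 1 := by omega
      rw [hN', Nat.cast_sub (by omega), ← hQ] at h1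
      have h2 : ∑ j ∈ Finset.range (N + 1), TT f S.fin φ (j + 1) (bInd f n x (ρ / 4)) x0 ≤
          ∑ j ∈ Finset.range (N + 1), TT f S.fin φ (j + 1) g x0 :=
        Finset.sum_le_sum fun j _ => TT_mono _ hg1 _
      have h3 := h1.trans h2
      have hN1 : (0 : ℝ) < (N : ℝ) + 1 := by positivity
      have h4 : Q - ((n + M) * Q) / ((N : ℝ) + 1) =
          ((N : ℝ) + 1)⁻¹ * ((((N + 1 : ℕ) : ℝ) - ((n + M : ℕ) : ℝ)) * Q) := by
        push_cast
        field_simp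
      rw [h4]
      refine mul_le_mul_of_nonneg_left (mul_le_mul_of_nonneg_left h3 (inv_pos.2 hN1).le) ?_
      positivity
    have := le_of_tendsto_of_tendsto hlim (hcv g hg) hev
    refine le_trans (le_of_eq ?_) this
    rw [hQ, sub_zero, sub_eq_add_neg, Real.exp_add]
    ring
  · obtain ⟨g, hg, hg1, hg2⟩ := bump hf n x (show ρ / 2 < ρ by linarith)
    have hg0 : ∀ y, 0 ≤ g y := fun y => (bInd_nonneg _ _ _ _).trans (hg1 y)
    have hgi : Integrable g μ :=
      hg.integrable_of_hasCompactSupport (HasCompactSupport.of_compactSpace g)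
    rw [← hIntg]
    refine (integral_mono (hbi _) hgi hg1).trans ?_
    set Q := D * Real.exp (birkhoffSum' f φ n x + K) with hQ
    have hlim : Tendsto (fun N : ℕ => (D * D) * (n * D / ((N : ℝ) + 1) + Q)) u
        (nhds ((D * D) * (0 + Q))) :=
      ((hinv0 (n * D)).add_const Q).const_mul _
    have hev : ∀ N, Lam S φ x0 (N + 1) g ≤ (D * D) * (n * D / ((N : ℝ) + 1) + Q) := by
      intro N
      refine (Lam_bounds S hD hZ x0 N g hg0).2.trans ?_
      have h1 := S.avg_upper hK hD (fun n x => (hZ n x).2) n x x0 (N + 1)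
      have h2 : ∑ j ∈ Finset.range (N + 1), TT f S.fin φ (j + 1) g x0 ≤
          ∑ j ∈ Finset.range (N + 1), TT f S.fin φ (j + 1) (bInd f n x ρ) x0 :=
        Finset.sum_le_sum fun j _ => TT_mono _ hg2 _
      have h3 := h2.trans h1
      rw [← hQ] at h3
      have hN1 : (0 : ℝ) < (N : ℝ) + 1 := by positivity
      have h4 : n * D / ((N : ℝ) + 1) + Q =
          ((N : ℝ) + 1)⁻¹ * (n * D + ((N + 1 : ℕ) : ℝ) * Q) := by
        push_cast
        field_simp
      rw [h4]
      refine mul_le_mul_of_nonneg_left (mul_le_mul_of_nonneg_left h3 (inv_pos.2 hN1).le) ?_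
      positivity
    have := le_of_tendsto_of_tendsto (hcv g hg) hlim (Filter.Eventually.of_forall hev)
    refine this.trans (le_of_eq ?_)
    rw [hQ, zero_add, Real.exp_add]
    ring
end

/-- **Existence of the invariant Gibbs measure.** There exist `P ∈ ℝ`, `r₀ > 0`,
`C ∈ (0,1]` and an `f`-invariant Borel probability measure `μ` with
`C ≤ μ(B_n(x,r₀)) * exp (n P - S_n φ x) ≤ C⁻¹` for all `x, n`; moreover `P`
can be taken to be the tree-pressure limit for any `x₀`. -/
theorem gibbs_measure_exists {X : Type*} [MetricSpace X] [CompactSpace X] [Nonempty X]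
    [MeasurableSpace X] [BorelSpace X]
    (f : X → X) (φ : X → ℝ) (hf : Continuous f) (hopen : IsOpenMap f)
    (hexp : DistanceExpanding f) (htrans : TopologicallyTransitive f)
    (hφ : HolderPotential φ) :
    ∃ P : ℝ, ∃ r₀ > (0 : ℝ), ∃ C ∈ Set.Ioc (0 : ℝ) 1, ∃ μ : Measure X,
      IsProbabilityMeasure μ ∧
      (∀ E : Set X, MeasurableSet E → μ (f ⁻¹' E) = μ E) ∧
      (∀ x : X, ∀ n : ℕ,
        C ≤ (μ (bowenBall f n x r₀)).toReal * Real.exp (n * P - birkhoffSum' f φ n x) ∧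
        (μ (bowenBall f n x r₀)).toReal * Real.exp (n * P - birkhoffSum' f φ n x) ≤ C⁻¹) ∧
      (∀ x₀ : X,
        Tendsto (fun n : ℕ => (1 / n : ℝ) * Real.log (treeSum f φ n x₀)) atTop (nhds P)) := by
  obtain ⟨lam, ρ, S⟩ := exists_gsys f hf hopen hexp htrans
  obtain ⟨P, D, hD, hZ⟩ := S.pressure htrans hφ
  have hD0 : 0 < D := by linarith
  have hψ : HolderPotential (fun y => φ y - P) := by
    obtain ⟨C, hC, b, hb, h⟩ := hφ
    refine ⟨C, hC, b, hb, fun x y => ?_⟩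
    rw [sub_sub_sub_cancel_right]
    exact h x y
  obtain ⟨c, hc, c', μ, hμ, hinv, hg⟩ := gibbs_core hf htrans S hψ hD
    (fun n x => by rw [TT_shift]; exact hZ n x)
  have hbs : ∀ (n : ℕ) (x : X), birkhoffSum' f (fun y => φ y - P) n x =
      -(n * P - birkhoffSum' f φ n x) := by
    intro n x
    simp [birkhoffSum', Finset.sum_sub_distrib]
  have hm : ∀ (x : X) (n : ℕ),
      c ≤ (μ (bowenBall f n x (ρ / 2))).toReal * Real.exp (n * P - birkhoffSum' f φ n x) ∧
      (μ (bowenBall f n x (ρ / 2))).toReal * Real.exp (n * P - birkhoffSum' f φ n x) ≤ c' := by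
    intro x n
    obtain ⟨h1, h2⟩ := hg x n
    rw [hbs, Real.exp_neg] at h1 h2
    have he := Real.exp_pos (n * P - birkhoffSum' f φ n x)
    exact ⟨(mul_inv_le_iff₀ he).1 h1, (le_mul_inv_iff₀ he).1 h2⟩
  refine ⟨P, ρ / 2, half_pos S.pos, min (min c 1) (max c' 1)⁻¹, ⟨?_, ?_⟩, μ, hμ, hinv, ?_, ?_⟩
  · have : (0 : ℝ) < max c' 1 := lt_max_of_lt_right one_pos
    exact lt_min (lt_min hc one_pos) (inv_pos.2 this)
  · exact (min_le_left _ _).trans (min_le_right _ _)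
  · intro x n
    have hp : (0 : ℝ) < max c' 1 := lt_max_of_lt_right one_pos
    refine ⟨((min_le_left _ _).trans (min_le_left _ _)).trans (hm x n).1, ?_⟩
    refine (hm x n).2.trans ((le_max_left c' 1).trans ?_)
    rw [le_inv_comm₀ hp (lt_min (lt_min hc one_pos) (inv_pos.2 hp))]
    exact min_le_right _ _
  · intro x₀
    have hL : ∀ n : ℕ, |Real.log (treeSum f φ n x₀) - n * P| ≤ Real.log D := by
      intro n
      rw [treeSum_eq (hfin := S.fin)]
      obtain ⟨h1, h2⟩ := hZ n x₀
      have hp := S.Z_pos φ n x₀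
      have e1 := Real.log_le_log (inv_pos.2 hD0) h1
      have e2 := Real.log_le_log (by positivity) h2
      rw [Real.log_mul (Real.exp_pos _).ne' hp.ne', Real.log_exp] at e1 e2
      rw [Real.log_inv] at e1
      rw [abs_le]
      constructor <;> linarith
    rw [tendsto_iff_norm_sub_tendsto_zero]
    refine squeeze_zero' (Filter.Eventually.of_forall fun _ => norm_nonneg _) ?_
      (tendsto_const_div_atTop_nhds_zero_nat (Real.log D))
    filter_upwards [eventually_gt_atTop 0] with n hn
    have hn' : (0 : ℝ) < n := by exact_mod_cast hn
    have : (1 / n : ℝ) * Real.log (treeSum f φ n x₀) - P =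
        (Real.log (treeSum f φ n x₀) - n * P) / n := by
      field_simp
    rw [this, Real.norm_eq_abs, abs_div, abs_of_pos hn']
    exact div_le_div_of_nonneg_right (hL n) hn'.le
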